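/- Let n ≥ 1 and let S = ℂ[x_1,y_1,…,x_n,y_n] be the polynomial ring in 2n variables over ℂ. For each i ∈ {1,…,n}, let f_i ∈ S be a nonzero squarefree polynomial involving only the two variables x_i, y_i which is homogeneous of degree d_i ≥ 1 in x_i, y_i; set f := f_1⋯f_n. For each i, let ν_i ∈ S^{2n} be the vector whose x_i-coordinate is ∂f_i/∂y_i, whose y_i-coordinate is −∂f_i/∂x_i, and whose other coordinates are 0, and let ε_i ∈ S^{2n} be the vector whose x_i-coordinate is x_i, whose y_i-coordinate is y_i, and whose other coordinates are 0. Then the 2n vectors ν_1,…,ν_n,ε_1,…,ε_n form a basis of the S-module D(f); in particular D(f) is a free S-module of rank 2n. (This is the module-level content of the paper's hypercube arrangement Example 4.3.) -/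

import Mathlib

open MvPolynomial

/-- The extended logarithmic derivation module `D(f)` over `ℂ[x_v : v ∈ σ]`:
all `μ` with `f ∣ Σ_v μ_v · ∂f/∂x_v`. -/
noncomputable def Dlog {σ : Type*} [Fintype σ] [DecidableEq σ] (f : MvPolynomial σ ℂ) :
    Submodule (MvPolynomial σ ℂ) (σ → MvPolynomial σ ℂ) where
  carrier := {μ | f ∣ ∑ v, μ v * pderiv v f}
  add_mem' {a b} ha hb := by
    simpa [add_mul, Finset.sum_add_distrib] using dvd_add ha hb
  zero_mem' := by simp
  smul_mem' c μ hμ := by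
    simpa [smul_eq_mul, mul_assoc, Finset.mul_sum] using hμ.mul_left c

namespace MvPolynomial

variable {σ K : Type*} [Field K]

theorem vars_subset_of_dvd {p q : MvPolynomial σ K} (h : p ∣ q) (hq : q ≠ 0) :
    p.vars ⊆ q.vars := by
  classical
  obtain ⟨r, rfl⟩ := h
  rw [vars_def, vars_def, degrees_mul_eq (left_ne_zero_of_mul hq) (right_ne_zero_of_mul hq)]
  exact Multiset.toFinset_subset.2 (Multiset.subset_of_le (Multiset.le_add_right _ _))

theorem isUnit_of_vars_eq_empty {p : MvPolynomial σ K} (hp : p ≠ 0) (h : p.vars = ∅) :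
    IsUnit p := by
  rw [vars_eq_empty_iff_eq_C] at h
  rw [h] at hp ⊢
  exact (isUnit_iff_ne_zero.2 fun h0 => hp (by rw [h0, C_0])).map C

theorem isRelPrime_of_disjoint_vars {p q : MvPolynomial σ K} (hp : p ≠ 0) (hq : q ≠ 0)
    (h : Disjoint p.vars q.vars) : IsRelPrime p q := fun _ hrp hrq =>
  isUnit_of_vars_eq_empty (ne_zero_of_dvd_ne_zero hp hrp) <| Finset.subset_empty.1 <|
    h (vars_subset_of_dvd hrp hp) (vars_subset_of_dvd hrq hq)

theorem notMem_vars_of_dvd_pderiv [CharZero K] {p : MvPolynomial σ K} {v : σ}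
    (h : p ∣ pderiv v p) : v ∉ p.vars := by
  classical
  intro hv
  obtain ⟨m, hm, hmv⟩ := mem_vars_iff_mem_support v |>.1 hv
  have hmv' : m v ≠ 0 := Finsupp.mem_support_iff.1 hmv
  have hd0 : pderiv v p ≠ 0 := by
    intro h0
    have hc := coeff_pderiv p (i := v) (m - Finsupp.single v 1)
    have hle : Finsupp.single v 1 ≤ m := by
      rw [Finsupp.single_le_iff]; omega
    rw [h0, coeff_zero, tsub_add_cancel_of_le hle] at hc
    rcases mul_eq_zero.1 hc.symm with h1 | h1
    · exact mem_support_iff.1 hm h1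
    · exact Nat.cast_add_one_ne_zero _ h1
  have hpos : 0 < degreeOf v p := (Nat.pos_of_ne_zero hmv').trans_le (monomial_le_degreeOf v hm)
  have hlt : degreeOf v (pderiv v p) < degreeOf v p := by
    rw [degreeOf_lt_iff hpos]
    intro k hk
    have hk' : k + Finsupp.single v 1 ∈ p.support := by
      rw [mem_support_iff, coeff_pderiv] at hk
      exact mem_support_iff.2 (left_ne_zero_of_mul hk)
    simpa using monomial_le_degreeOf v hk'
  obtain ⟨r, hr⟩ := h
  rw [hr] at hd0 hlt
  rw [degreeOf_mul_eq (left_ne_zero_of_mul hd0) (right_ne_zero_of_mul hd0)] at hlt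
  omega

variable {f : MvPolynomial σ K} {a b : σ} {d : ℕ}

theorem IsHomogeneous.X_mul_pderiv_add_X_mul_pderiv [Fintype σ] (hf : f.IsHomogeneous d)
    (hab : a ≠ b) (hvars : ↑f.vars ⊆ ({a, b} : Set σ)) :
    X a * pderiv a f + X b * pderiv b f = d • f := by
  rw [← hf.sum_X_mul_pderiv]
  symm
  refine Fintype.sum_eq_add a b hab fun v hv => ?_
  rw [pderiv_eq_zero_of_notMem_vars fun h => ?_, mul_zero]
  rcases hvars h with h | h
  · exact hv.1 h
  · exact hv.2 h

theorem IsHomogeneous.isRelPrime_pderiv [CharZero K] [Fintype σ] (hf : f.IsHomogeneous d)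
    (hd : d ≠ 0) (hsq : Squarefree f) (hab : a ≠ b) (hvars : ↑f.vars ⊆ ({a, b} : Set σ)) :
    IsRelPrime (pderiv a f) (pderiv b f) := by
  have euler := hf.X_mul_pderiv_add_X_mul_pderiv hab hvars
  have hf0 : f ≠ 0 := hsq.ne_zero
  have hdu : IsUnit (d : MvPolynomial σ K) := by
    simpa using (isUnit_iff_ne_zero.2 (Nat.cast_ne_zero.2 hd : (d : K) ≠ 0)).map
      (C : K →+* MvPolynomial σ K)
  rw [nsmul_eq_mul] at euler
  refine WfDvdMonoid.isRelPrime_of_no_irreducible_factors ?_ ?_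
  · rintro ⟨h1, h2⟩
    rw [h1, h2, mul_zero, mul_zero, add_zero] at euler
    exact mul_ne_zero hdu.ne_zero hf0 euler.symm
  intro p hp hpa hpb
  have hpf : p ∣ f := by
    rw [← hdu.dvd_mul_left, ← euler]
    exact dvd_add (hpa.mul_left _) (hpb.mul_left _)
  obtain ⟨h, rfl⟩ := hpf
  have hph : ¬ p ∣ h := fun hdvd => hp.not_isUnit (hsq p (mul_dvd_mul_left p hdvd))
  have key (v : σ) (hv : p ∣ pderiv v (p * h)) : v ∉ p.vars := by
    rw [pderiv_mul, dvd_add_left (dvd_mul_right _ _)] at hv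
    exact notMem_vars_of_dvd_pderiv ((hp.prime.dvd_or_dvd hv).resolve_right hph)
  refine hp.not_isUnit (isUnit_of_vars_eq_empty hp.ne_zero (Finset.eq_empty_of_forall_notMem ?_))
  intro v hv
  rcases hvars (vars_subset_of_dvd (dvd_mul_right p h) hf0 hv) with rfl | rfl
  · exact key _ hpa hv
  · exact key _ hpb hv

end MvPolynomial

theorem IsRelPrime.exists_of_mul_add_mul_eq_zero {R : Type*} [CommRing R] [IsDomain R]
    [DecompositionMonoid R] {p q a b : R} (h : IsRelPrime p q) (h0 : a * p + b * q = 0) :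
    ∃ c, a = c * q ∧ b = -(c * p) := by
  by_cases hq : q = 0
  · have hp : p ≠ 0 := (h.ne_zero_or_ne_zero).resolve_right (by simp [hq])
    obtain ⟨c, hc⟩ := h.dvd_of_dvd_mul_right (y := b) ⟨-a, by linear_combination h0⟩
    refine ⟨-c, ?_, by rw [hc]; ring⟩
    subst hq
    simpa [hp] using h0
  · obtain ⟨c, hc⟩ := h.symm.dvd_of_dvd_mul_right (y := a) ⟨-b, by linear_combination h0⟩
    refine ⟨c, by rw [hc]; ring, mul_right_cancel₀ hq ?_⟩
    rw [hc] at h0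
    linear_combination h0

/-- A plane-curve logarithmic vector field is a combination of the Hamiltonian and Euler fields. -/
theorem MvPolynomial.IsHomogeneous.exists_of_dvd_mul_pderiv_add {σ K : Type*} [Field K] [CharZero K]
    [Fintype σ] {f : MvPolynomial σ K} {a b : σ} {d : ℕ} (hf : f.IsHomogeneous d)
    (hd : d ≠ 0) (hsq : Squarefree f) (hab : a ≠ b) (hvars : ↑f.vars ⊆ ({a, b} : Set σ))
    {s t : MvPolynomial σ K} (h : f ∣ s * pderiv a f + t * pderiv b f) :
    ∃ c e, c * pderiv b f + e * X a = s ∧ -(c * pderiv a f) + e * X b = t := by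
  obtain ⟨g, hg⟩ := h
  have euler := hf.X_mul_pderiv_add_X_mul_pderiv hab hvars
  have hinv : C (d : K)⁻¹ * (d : MvPolynomial σ K) = 1 := by
    rw [← map_natCast (C : K →+* MvPolynomial σ K), ← map_mul,
      inv_mul_cancel₀ (Nat.cast_ne_zero.2 hd), map_one]
  rw [nsmul_eq_mul] at euler
  obtain ⟨c, h1, h2⟩ := (hf.isRelPrime_pderiv hd hsq hab hvars).exists_of_mul_add_mul_eq_zero
    (a := s - g * C (d : K)⁻¹ * X a) (b := t - g * C (d : K)⁻¹ * X b)
    (by linear_combination hg - g * C (d : K)⁻¹ * euler - g * f * hinv)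
  exact ⟨c, g * C (d : K)⁻¹, by linear_combination -h1, by linear_combination -h2⟩

/-- Module-level content of the hypercube arrangement Example 4.3. The `2n` variables of
`S = ℂ[x_1,y_1,…,x_n,y_n]` are indexed by `Fin n × Bool`, `x_i = X (i, false)` and
`y_i = X (i, true)`. If each `f_i` is a nonzero squarefree polynomial in `x_i, y_i` only,
homogeneous of degree `d_i ≥ 1`, and `f = f_1⋯f_n`, then the `2n` vectors
`ν_1,…,ν_n, ε_1,…,ε_n` form a basis of `D(f)`; in particular `D(f)` is free of rank `2n`. -/
theorem hypercube_arrangement_free (n : ℕ) (hn : 1 ≤ n)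
    (f : Fin n → MvPolynomial (Fin n × Bool) ℂ)
    (hf0 : ∀ i, f i ≠ 0) (hsq : ∀ i, Squarefree (f i))
    (hvars : ∀ i, ↑(f i).vars ⊆ ({(i, false), (i, true)} : Set (Fin n × Bool)))
    (d : Fin n → ℕ) (hd : ∀ i, 1 ≤ d i)
    (hhom : ∀ i, (f i).IsHomogeneous (d i))
    (F : MvPolynomial (Fin n × Bool) ℂ) (hF : F = ∏ i, f i)
    (ν ε : Fin n → (Fin n × Bool) → MvPolynomial (Fin n × Bool) ℂ)
    (hν : ∀ i v, ν i v =
      if v = (i, false) then pderiv (i, true) (f i)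
      else if v = (i, true) then -pderiv (i, false) (f i) else 0)
    (hε : ∀ i v, ε i v =
      if v = (i, false) then X (i, false)
      else if v = (i, true) then X (i, true) else 0) :
    LinearIndependent (MvPolynomial (Fin n × Bool) ℂ) (Sum.elim ν ε) ∧
      Submodule.span (MvPolynomial (Fin n × Bool) ℂ) (Set.range (Sum.elim ν ε)) = Dlog F := by
  have hνf (i j) : ν j (i, false) = if i = j then pderiv (i, true) (f i) else 0 := by
    rw [hν]; by_cases h : i = j <;> simp [h]
  have hνt (i j) : ν j (i, true) = if i = j then -pderiv (i, false) (f i) else 0 := by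
    rw [hν]; by_cases h : i = j <;> simp [h]
  have hεf (i j) : ε j (i, false) = if i = j then X (i, false) else 0 := by
    rw [hε]; by_cases h : i = j <;> simp [h]
  have hεt (i j) : ε j (i, true) = if i = j then X (i, true) else 0 := by
    rw [hε]; by_cases h : i = j <;> simp [h]
  have hcombf (g : Fin n ⊕ Fin n → MvPolynomial (Fin n × Bool) ℂ) (i) :
      (∑ k, g k • Sum.elim ν ε k) (i, false) =
        g (.inl i) * pderiv (i, true) (f i) + g (.inr i) * X (i, false) := by
    simp [Fintype.sum_sum_type, hνf, hεf]
  have hcombt (g : Fin n ⊕ Fin n → MvPolynomial (Fin n × Bool) ℂ) (i) :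
      (∑ k, g k • Sum.elim ν ε k) (i, true) =
        -(g (.inl i) * pderiv (i, false) (f i)) + g (.inr i) * X (i, true) := by
    simp [Fintype.sum_sum_type, hνt, hεt]
  have hne (i : Fin n) : ((i, false) : Fin n × Bool) ≠ (i, true) := by simp
  have hd0 (i) : d i ≠ 0 := Nat.one_le_iff_ne_zero.1 (hd i)
  have euler (i) := (hhom i).X_mul_pderiv_add_X_mul_pderiv (hne i) (hvars i)
  have hfst {i v} (hv : v ∈ (f i).vars) : v.1 = i := by
    rcases hvars i hv with rfl | rfl <;> rfl
  have hFi (i) : F = f i * ∏ j ∈ Finset.univ.erase i, f j := by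
    rw [hF, Finset.mul_prod_erase _ _ (Finset.mem_univ i)]
  have hpd (i c) : pderiv (i, c) F =
      pderiv (i, c) (f i) * ∏ j ∈ Finset.univ.erase i, f j := by
    rw [hFi i, pderiv_mul, pderiv_eq_zero_of_notMem_vars (f := ∏ j ∈ _, f j), mul_zero, add_zero]
    intro h
    obtain ⟨j, hj, hv⟩ := Finset.mem_biUnion.1 (vars_prod _ h)
    exact (Finset.mem_erase.1 hj).1 (hfst hv).symm
  have hsum (μ : Fin n × Bool → MvPolynomial (Fin n × Bool) ℂ) : ∑ v, μ v * pderiv v F =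
      ∑ i, (μ (i, false) * pderiv (i, false) (f i) + μ (i, true) * pderiv (i, true) (f i)) *
        ∏ j ∈ Finset.univ.erase i, f j := by
    rw [Fintype.sum_prod_type]
    refine Finset.sum_congr rfl fun i _ => ?_
    rw [Fintype.sum_bool, hpd, hpd]
    ring
  refine ⟨?_, le_antisymm ?_ ?_⟩
  · rw [Fintype.linearIndependent_iff]
    intro g hg
    have hzero (i) : g (.inl i) = 0 ∧ g (.inr i) = 0 := by
      have h1 := hcombf g i
      have h2 := hcombt g i
      rw [hg, Pi.zero_apply] at h1 h2
      have hr : g (.inr i) = 0 := by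
        have h3 : g (.inr i) * (d i • f i) = 0 := by
          linear_combination -pderiv (i, false) (f i) * h1 - pderiv (i, true) (f i) * h2
            - g (.inr i) * euler i
        exact (mul_eq_zero.1 h3).resolve_right (smul_ne_zero (hd0 i) (hf0 i))
      rw [hr, zero_mul, add_zero] at h1 h2
      refine ⟨?_, hr⟩
      by_contra hl
      refine smul_ne_zero (hd0 i) (hf0 i) ((euler i).symm.trans ?_)
      rw [(mul_eq_zero.1 h1.symm).resolve_left hl,
        (mul_eq_zero.1 (neg_eq_zero.1 h2.symm)).resolve_left hl, mul_zero, mul_zero, add_zero]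
    rintro (i | i)
    exacts [(hzero i).1, (hzero i).2]
  · rw [Submodule.span_le]
    rintro _ ⟨k, rfl⟩
    change F ∣ ∑ v, Sum.elim ν ε k v * pderiv v F
    rw [hsum]
    refine Finset.dvd_sum fun i _ => ?_
    rw [hFi i]
    refine mul_dvd_mul_right ?_ _
    rcases k with k | k
    · rw [Sum.elim_inl, hνf, hνt]
      split_ifs
      · exact ⟨0, by ring⟩
      · simp
    · rw [Sum.elim_inr, hεf, hεt]
      split_ifs
      · rw [euler i]
        exact dvd_smul_of_dvd _ dvd_rfl
      · simp
  · intro μ hμ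
    change F ∣ ∑ v, μ v * pderiv v F at hμ
    rw [hsum] at hμ
    have hdvd (i) : f i ∣
        μ (i, false) * pderiv (i, false) (f i) + μ (i, true) * pderiv (i, true) (f i) := by
      have hrel : IsRelPrime (f i) (∏ j ∈ Finset.univ.erase i, f j) := by
        refine IsRelPrime.prod_right fun j hj =>
          isRelPrime_of_disjoint_vars (hf0 i) (hf0 j) (Finset.disjoint_left.2 fun v hi hj' => ?_)
        exact (Finset.mem_erase.1 hj).1 ((hfst hj').symm.trans (hfst hi))
      refine hrel.dvd_of_dvd_mul_right ?_
      have hi := (Dvd.intro _ (hFi i).symm).trans hμ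
      rw [← Finset.add_sum_erase _ _ (Finset.mem_univ i)] at hi
      refine (dvd_add_left (Finset.dvd_sum fun j hj => ?_)).1 hi
      exact (Finset.dvd_prod_of_mem f (Finset.mem_erase.2
        ⟨(Finset.mem_erase.1 hj).1.symm, Finset.mem_univ i⟩)).mul_left _
    choose c e h1 h2 using fun i =>
      (hhom i).exists_of_dvd_mul_pderiv_add (hd0 i) (hsq i) (hne i) (hvars i) (hdvd i)
    rw [Submodule.mem_span_range_iff_exists_fun]
    refine ⟨Sum.elim c e, funext ?_⟩
    rintro ⟨i, _ | _⟩
    · exact (hcombf _ i).trans (h1 i)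
    · exact (hcombt _ i).trans (h2 i)
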